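/- Let n be larger than a suitable universal constant, let 0 < t ≤ 20 n^{−2} log n and 1 ≤ a_0 ≤ 1 + 10/n, let C_0 > 0 be a fixed universal constant, and consider the spherical shell R = { x ∈ R^n : 1/a_0 ≤ |x|^2 < 1/(a_0 − C_0 √(tn)) }. Then ∫_R Φ( t^{−1/2}( a_0 − 1/|x|^2 ) ) dx ≤ C e^{n^2 t / 8} · Vol_n(B^n), where C > 0 is a universal constant (depending on C_0). -/

import Mathlib

/- STATEMENT 14 (Lemma 4.4): For n larger than a universal constant, 0 < t ≤ 20 n^{−2} log n,
1 ≤ a_0 ≤ 1 + 10/n, C_0 > 0 a fixed universal constant, and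
R = { x ∈ R^n : 1/a_0 ≤ |x|² < 1/(a_0 − C_0 √(tn)) }, one has
∫_R Φ( t^{−1/2}(a_0 − 1/|x|²) ) dx ≤ C e^{n²t/8} · Vol_n(B^n), where C > 0 depends only
on C_0. -/

open MeasureTheory
noncomputable section

abbrev Euc (n : ℕ) := EuclideanSpace ℝ (Fin n)

/-- The Gaussian tail bound function Φ(r) = min{1/2, e^{−r²/2}/(√(2π)·r)} for r > 0,
with Φ(0) = 1/2. -/
def Phi (r : ℝ) : ℝ :=
  if r = 0 then 1 / 2
  else min (1 / 2) (Real.exp (-(r ^ 2) / 2) / (Real.sqrt (2 * Real.pi) * r))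

lemma Phi_nonneg {r : ℝ} (hr : 0 ≤ r) : 0 ≤ Phi r := by
  unfold Phi
  split_ifs <;> positivity

lemma measurable_Phi : Measurable Phi := by
  unfold Phi
  exact Measurable.ite (measurableSet_singleton 0) measurable_const (by fun_prop)

lemma Phi_le_exp_div_max {r : ℝ} (hr : 0 ≤ r) :
    Phi r ≤ Real.exp (-(r ^ 2) / 2) / max 1 r := by
  rcases le_total r 1 with h | h
  · have h1 : Phi r ≤ 1 / 2 := by
      unfold Phi
      split_ifs
      · exact le_rfl
      · exact min_le_left _ _
    have h2 : -(r ^ 2) / 2 + 1 ≤ Real.exp (-(r ^ 2) / 2) := Real.add_one_le_exp _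
    rw [max_eq_left h, div_one]
    nlinarith
  · have hr0 : 0 < r := by linarith
    have h1 : (1 : ℝ) ≤ Real.sqrt (2 * Real.pi) := by
      rw [Real.one_le_sqrt]
      linarith [Real.pi_gt_three]
    rw [max_eq_right h, Phi, if_neg hr0.ne']
    refine (min_le_right _ _).trans ?_
    gcongr
    nlinarith

/-- `Phi` is dominated by a constant multiple of the Gaussian tail integral. -/
lemma ofReal_Phi_le_lintegral_Ici {r : ℝ} (hr : 0 ≤ r) :
    ENNReal.ofReal (Phi r) ≤ ENNReal.ofReal (Real.exp (3 / 2)) *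
      ∫⁻ u in Set.Ici r, ENNReal.ofReal (Real.exp (-(u ^ 2) / 2)) := by
  set M := max 1 r
  have hM1 : 1 ≤ M := le_max_left _ _
  have hMr : r ≤ M := le_max_right _ _
  have hM : 0 < M := by linarith
  have hinv : M * (1 / M) = 1 := by field_simp
  have hpos : 0 < 1 / M := by positivity
  have hle : 1 / M ≤ 1 := by rw [div_le_one hM]; exact hM1
  have hrM : r * (1 / M) ≤ 1 := by nlinarith
  calc ENNReal.ofReal (Phi r)
      ≤ ENNReal.ofReal (Real.exp (3 / 2) * (Real.exp (-(r ^ 2 + 3) / 2) * (1 / M))) := by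
        apply ENNReal.ofReal_le_ofReal
        refine (Phi_le_exp_div_max hr).trans (le_of_eq ?_)
        rw [← mul_assoc, ← Real.exp_add, mul_one_div]
        congr 2
        ring
    _ = ENNReal.ofReal (Real.exp (3 / 2)) *
          ∫⁻ _ in Set.Icc r (r + 1 / M), ENNReal.ofReal (Real.exp (-(r ^ 2 + 3) / 2)) := by
        rw [ENNReal.ofReal_mul (by positivity), ENNReal.ofReal_mul (by positivity),
          setLIntegral_const, Real.volume_Icc, add_sub_cancel_left]
    _ ≤ ENNReal.ofReal (Real.exp (3 / 2)) *
          ∫⁻ u in Set.Icc r (r + 1 / M), ENNReal.ofReal (Real.exp (-(u ^ 2) / 2)) := by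
        refine mul_le_mul_right (setLIntegral_mono' measurableSet_Icc fun u hu => ?_) _
        apply ENNReal.ofReal_le_ofReal
        apply Real.exp_le_exp.mpr
        have : u ^ 2 ≤ (r + 1 / M) ^ 2 := pow_le_pow_left₀ (hr.trans hu.1) hu.2 2
        nlinarith
    _ ≤ _ := by
        gcongr
        exact Set.Icc_subset_Ici_self

lemma one_div_one_sub_le_exp {s : ℝ} (h0 : 0 ≤ s) (h1 : s ≤ 1 / 2) :
    1 / (1 - s) ≤ Real.exp (s + s ^ 2) := by
  have h := Real.quadratic_le_exp_of_nonneg (x := s + s ^ 2) (by positivity)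
  refine le_trans ?_ h
  rw [div_le_iff₀ (by linarith)]
  have : 0 ≤ s ^ 2 * ((1 - s) * (1 + s) ^ 2 / 2 - s) := by
    apply mul_nonneg (by positivity)
    nlinarith [mul_nonneg h0 (sub_nonneg.mpr h1), mul_nonneg (mul_nonneg h0 h0) (sub_nonneg.mpr h1)]
  nlinarith

lemma norm_le_exp_of_sub_one_div_sq_le {E : Type*} [NormedAddCommGroup E] {x : E} {a v : ℝ}
    (ha : 1 ≤ a) (h0 : 0 ≤ a - 1 / ‖x‖ ^ 2) (h1 : a - 1 / ‖x‖ ^ 2 ≤ 1 / 2)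
    (hv : a - 1 / ‖x‖ ^ 2 ≤ v) : ‖x‖ ≤ Real.exp ((v + v ^ 2) / 2) := by
  set s := a - 1 / ‖x‖ ^ 2 with hs
  have hsq : ‖x‖ ^ 2 = 1 / (a - s) := by
    rw [hs, sub_sub_cancel, one_div_one_div]
  have h : ‖x‖ ^ 2 ≤ Real.exp ((v + v ^ 2) / 2) ^ 2 := by
    calc ‖x‖ ^ 2 = 1 / (a - s) := hsq
      _ ≤ 1 / (1 - s) := by
        apply one_div_le_one_div_of_le <;> linarith
      _ ≤ Real.exp (s + s ^ 2) := one_div_one_sub_le_exp h0 h1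
      _ ≤ Real.exp (v + v ^ 2) := by gcongr
      _ = Real.exp ((v + v ^ 2) / 2) ^ 2 := by
        rw [← Real.exp_nat_mul]
        congr 1
        push_cast
        ring
  exact le_of_sq_le_sq h (Real.exp_pos _).le

lemma lintegral_exp_neg_sq_div_four :
    ∫⁻ v : ℝ, ENNReal.ofReal (Real.exp (-(v ^ 2) / 4)) =
      ENNReal.ofReal (Real.sqrt (4 * Real.pi)) := by
  have h : ∀ v : ℝ, -(v ^ 2) / 4 = -(1 / 4) * v ^ 2 := fun v => by ring
  simp_rw [h]
  rw [← ofReal_integral_eq_lintegral_ofReal (integrable_exp_neg_mul_sq (by norm_num))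
    (Filter.Eventually.of_forall fun _ => (Real.exp_pos _).le), integral_gaussian]
  congr 2
  ring

/-- The Gaussian moment bound behind the main estimate: the factor `exp (n ^ 2 t / 8)` is the
Laplace transform of a standard Gaussian at `n √t / 2`. -/
lemma lintegral_exp_quadratic_le {n t : ℝ} (ht : 0 < t) (hn : 0 ≤ n)
    (h1 : n * t ≤ 1 / 4) (h2 : n ^ 3 * t ^ 2 ≤ 4) :
    ∫⁻ u : ℝ, ENNReal.ofReal (Real.exp (-(u ^ 2) / 2) *
        Real.exp (n * ((u * Real.sqrt t + (u * Real.sqrt t) ^ 2) / 2))) ≤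
      ENNReal.ofReal (Real.exp (n ^ 2 * t / 8 + 1)) *
        ENNReal.ofReal (Real.sqrt (4 * Real.pi)) := by
  rw [← lintegral_add_right_eq_self _ (n * Real.sqrt t / 2), ← lintegral_exp_neg_sq_div_four,
    ← lintegral_const_mul _ (by fun_prop)]
  refine lintegral_mono fun v => ?_
  rw [← ENNReal.ofReal_mul (Real.exp_pos _).le, ← Real.exp_add, ← Real.exp_add]
  apply ENNReal.ofReal_le_ofReal
  apply Real.exp_le_exp.mpr
  have hs : Real.sqrt t ^ 2 = t := Real.sq_sqrt ht.le
  set w := Real.sqrt t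
  rw [← hs] at h1 h2 ⊢
  have e1 : 0 ≤ n * w ^ 2 * (v - n * w / 2) ^ 2 := by positivity
  have e2 : 0 ≤ (1 / 4 - n * w ^ 2) * v ^ 2 :=
    mul_nonneg (by linarith) (sq_nonneg v)
  nlinarith

lemma exists_forall_log_sq_le {ε : ℝ} (hε : 0 < ε) :
    ∃ N : ℕ, ∀ n : ℕ, N ≤ n → Real.log n ^ 2 ≤ ε * n := by
  have h := (Real.isLittleO_pow_log_id_atTop (n := 2)).bound hε
  obtain ⟨N, hN⟩ := Filter.eventually_atTop.mp (tendsto_natCast_atTop_atTop.eventually h)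
  refine ⟨N, fun n hn => ?_⟩
  have := hN n hn
  simpa using this

/-- Large-dimension bounds on `n t` and `n ^ 3 t ^ 2` in the regime `t ≤ 20 n⁻² log n`. -/
lemma exists_forall_cube_mul_sq_le {δ : ℝ} (hδ : 0 < δ) :
    ∃ N : ℕ, ∀ n : ℕ, N ≤ n → ∀ t : ℝ, 0 < t → t ≤ 20 * Real.log n / (n : ℝ) ^ 2 →
      n * t ≤ δ ∧ (n : ℝ) ^ 3 * t ^ 2 ≤ δ ^ 2 := by
  obtain ⟨N, hN⟩ := exists_forall_log_sq_le (ε := δ ^ 2 / 400) (by positivity)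
  refine ⟨max N 1, fun n hn t ht0 ht => ?_⟩
  have hn1 : (1 : ℝ) ≤ n := by exact_mod_cast (le_max_right _ _).trans hn
  have hlog := hN n ((le_max_left _ _).trans hn)
  rw [le_div_iff₀ (by positivity)] at ht
  have hsq : (t * (n : ℝ) ^ 2) ^ 2 ≤ (20 * Real.log n) ^ 2 :=
    pow_le_pow_left₀ (by positivity) ht 2
  have h3 : (n : ℝ) ^ 3 * t ^ 2 ≤ δ ^ 2 := by
    have : (n : ℝ) * ((n : ℝ) ^ 3 * t ^ 2) ≤ n * δ ^ 2 := by nlinarith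
    exact le_of_mul_le_mul_left this (by linarith)
  refine ⟨?_, h3⟩
  have h4 : (n * t) ^ 2 ≤ δ ^ 2 := by
    refine le_trans ?_ h3
    have : 0 ≤ (n - 1 : ℝ) * ((n : ℝ) * t) ^ 2 :=
      mul_nonneg (by linarith) (sq_nonneg _)
    nlinarith
  exact le_of_sq_le_sq h4 hδ.le

/-- Tonelli estimate for `Phi` of a nonnegative function, in terms of its sublevel sets. -/
lemma setLIntegral_Phi_div_le {α : Type*} [MeasurableSpace α] {μ : Measure α} [SFinite μ]
    {R : Set α} (hR : MeasurableSet R) {f : α → ℝ} (hf : Measurable f)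
    (hf0 : ∀ x ∈ R, 0 ≤ f x) {w : ℝ} (hw : 0 < w) :
    ∫⁻ x in R, ENNReal.ofReal (Phi (f x / w)) ∂μ ≤
      ENNReal.ofReal (Real.exp (3 / 2)) *
        ∫⁻ u : ℝ, ENNReal.ofReal (Real.exp (-(u ^ 2) / 2)) * μ {x ∈ R | f x ≤ u * w} := by
  have hS : MeasurableSet {p : α × ℝ | f p.1 ≤ p.2 * w} :=
    measurableSet_le (by fun_prop) (by fun_prop)
  let g : α → ℝ → ENNReal := fun x u =>
    {p : α × ℝ | f p.1 ≤ p.2 * w}.indicator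
      (fun p => ENNReal.ofReal (Real.exp (-(p.2 ^ 2) / 2))) (x, u)
  have hg : Measurable (Function.uncurry g) := Measurable.indicator (by fun_prop) hS
  calc ∫⁻ x in R, ENNReal.ofReal (Phi (f x / w)) ∂μ
      ≤ ∫⁻ x in R, ENNReal.ofReal (Real.exp (3 / 2)) * (∫⁻ u, g x u) ∂μ := by
        refine setLIntegral_mono' hR fun x hx => ?_
        refine (ofReal_Phi_le_lintegral_Ici (div_nonneg (hf0 x hx) hw.le)).trans (le_of_eq ?_)
        rw [← lintegral_indicator measurableSet_Ici]
        congr 2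
        ext u
        simp only [g, Set.indicator, Set.mem_Ici, Set.mem_ofPred_eq, div_le_iff₀ hw]
    _ = ENNReal.ofReal (Real.exp (3 / 2)) * ∫⁻ u, (∫⁻ x in R, g x u ∂μ) := by
        rw [lintegral_const_mul' _ _ ENNReal.ofReal_ne_top,
          lintegral_lintegral_swap hg.aemeasurable]
    _ = _ := by
        congr 2
        ext u
        have hu : MeasurableSet {x | f x ≤ u * w} := measurableSet_le hf measurable_const
        have : ∀ x, g x u = {x | f x ≤ u * w}.indicator
            (fun _ => ENNReal.ofReal (Real.exp (-(u ^ 2) / 2))) x := fun x => rfl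
        simp_rw [this]
        rw [lintegral_indicator_const hu, Measure.restrict_apply hu, Set.inter_comm]
        rfl

theorem shell_integral_of_Phi_le :
    ∀ C₀ : ℝ, 0 < C₀ → ∃ C : ℝ, 0 < C ∧ ∃ N : ℕ, ∀ n : ℕ, N ≤ n →
      ∀ t a0 : ℝ, 0 < t → t ≤ 20 * Real.log n / (n : ℝ) ^ 2 →
        1 ≤ a0 → a0 ≤ 1 + 10 / (n : ℝ) →
        (∫ x in {x : Euc n | 1 / a0 ≤ ‖x‖ ^ 2 ∧
            ‖x‖ ^ 2 < 1 / (a0 - C₀ * Real.sqrt (t * n))},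
          Phi ((a0 - 1 / ‖x‖ ^ 2) / Real.sqrt t)) ≤
        C * Real.exp ((n : ℝ) ^ 2 * t / 8) *
          (volume (Metric.ball (0 : Euc n) 1)).toReal := by
  intro C₀ hC₀
  refine ⟨Real.exp (3 / 2) * Real.exp 1 * Real.sqrt (4 * Real.pi), by positivity, ?_⟩
  obtain ⟨N, hN⟩ := exists_forall_cube_mul_sq_le (δ := min (1 / 4) ((1 / (2 * C₀)) ^ 2))
    (by positivity)
  refine ⟨N, fun n hn t a0 ht0 ht ha _ => ?_⟩
  obtain ⟨h1, h2⟩ := hN n hn t ht0 ht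
  have hnt : n * t ≤ 1 / 4 := h1.trans (min_le_left _ _)
  have hn3 : (n : ℝ) ^ 3 * t ^ 2 ≤ 4 := by
    refine h2.trans ((pow_le_pow_left₀ (by positivity) (min_le_left _ _) 2).trans ?_)
    norm_num
  have hS : C₀ * Real.sqrt (t * n) ≤ 1 / 2 := by
    have : Real.sqrt (t * n) ≤ 1 / (2 * C₀) := by
      apply Real.sqrt_le_iff.mpr
      exact ⟨by positivity, by rw [mul_comm]; exact h1.trans (min_le_right _ _)⟩
    calc C₀ * Real.sqrt (t * n) ≤ C₀ * (1 / (2 * C₀)) := by gcongr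
      _ = 1 / 2 := by field_simp
  set S := C₀ * Real.sqrt (t * n)
  set w := Real.sqrt t
  have hw : 0 < w := Real.sqrt_pos.mpr ht0
  set R := {x : Euc n | 1 / a0 ≤ ‖x‖ ^ 2 ∧ ‖x‖ ^ 2 < 1 / (a0 - S)}
  have hR : MeasurableSet R :=
    (measurableSet_le measurable_const (measurable_norm.pow_const 2)).inter
      (measurableSet_lt (measurable_norm.pow_const 2) measurable_const)
  have hsq : ∀ x ∈ R, 0 < ‖x‖ ^ 2 := fun x hx => lt_of_lt_of_le (by positivity) hx.1
  have hf0 : ∀ x ∈ R, 0 ≤ a0 - 1 / ‖x‖ ^ 2 := fun x hx => by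
    rw [sub_nonneg, one_div_le (hsq x hx) (by linarith)]
    exact hx.1
  have hf1 : ∀ x ∈ R, a0 - 1 / ‖x‖ ^ 2 ≤ 1 / 2 := fun x hx => by
    have := (lt_one_div (hsq x hx) (by linarith)).mp hx.2
    linarith
  have hf : Measurable fun x : Euc n => a0 - 1 / ‖x‖ ^ 2 := by fun_prop
  have hball : volume (Metric.ball (0 : Euc n) 1) ≠ ⊤ := measure_ball_lt_top.ne
  have hvol : ∀ u : ℝ, volume {x ∈ R | a0 - 1 / ‖x‖ ^ 2 ≤ u * w} ≤
      ENNReal.ofReal (Real.exp (n * ((u * w + (u * w) ^ 2) / 2))) *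
        volume (Metric.ball (0 : Euc n) 1) := fun u => by
    calc volume {x ∈ R | a0 - 1 / ‖x‖ ^ 2 ≤ u * w}
        ≤ volume (Metric.closedBall (0 : Euc n) (Real.exp ((u * w + (u * w) ^ 2) / 2))) := by
          refine measure_mono fun x hx => ?_
          rw [mem_closedBall_zero_iff]
          exact norm_le_exp_of_sub_one_div_sq_le ha (hf0 x hx.1) (hf1 x hx.1) hx.2
      _ = _ := by
          rw [Measure.addHaar_closedBall _ _ (Real.exp_pos _).le, finrank_euclideanSpace_fin,
            ← Real.exp_nat_mul]
  have key : ∫⁻ x in R, ENNReal.ofReal (Phi ((a0 - 1 / ‖x‖ ^ 2) / w)) ≤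
      ENNReal.ofReal (Real.exp (3 / 2) * Real.exp 1 * Real.sqrt (4 * Real.pi) *
        Real.exp ((n : ℝ) ^ 2 * t / 8) * (volume (Metric.ball (0 : Euc n) 1)).toReal) := by
    calc ∫⁻ x in R, ENNReal.ofReal (Phi ((a0 - 1 / ‖x‖ ^ 2) / w))
        ≤ ENNReal.ofReal (Real.exp (3 / 2)) * ∫⁻ u : ℝ, ENNReal.ofReal (Real.exp (-(u ^ 2) / 2)) *
            volume {x ∈ R | a0 - 1 / ‖x‖ ^ 2 ≤ u * w} := setLIntegral_Phi_div_le hR hf hf0 hw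
      _ ≤ ENNReal.ofReal (Real.exp (3 / 2)) * ∫⁻ u : ℝ, ENNReal.ofReal (Real.exp (-(u ^ 2) / 2) *
            Real.exp (n * ((u * w + (u * w) ^ 2) / 2))) *
              volume (Metric.ball (0 : Euc n) 1) := by
          refine mul_le_mul_right (lintegral_mono fun u => ?_) _
          rw [ENNReal.ofReal_mul (Real.exp_pos _).le, mul_assoc]
          gcongr
          exact hvol u
      _ ≤ ENNReal.ofReal (Real.exp (3 / 2)) *
            (ENNReal.ofReal (Real.exp ((n : ℝ) ^ 2 * t / 8 + 1)) *
              ENNReal.ofReal (Real.sqrt (4 * Real.pi)) *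
                volume (Metric.ball (0 : Euc n) 1)) := by
          rw [lintegral_mul_const' _ _ hball]
          gcongr
          exact lintegral_exp_quadratic_le ht0 n.cast_nonneg hnt hn3
      _ = _ := by
          rw [← ENNReal.ofReal_toReal hball, ← ENNReal.ofReal_mul (by positivity),
            ← ENNReal.ofReal_mul (by positivity), ← ENNReal.ofReal_mul (by positivity),
            ENNReal.toReal_ofReal (by positivity), Real.exp_add]
          congr 1
          ring
  rw [integral_eq_lintegral_of_nonneg_ae]
  · exact ENNReal.toReal_le_of_le_ofReal (by positivity) key
  · filter_upwards [ae_restrict_mem hR] with x hx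
    exact Phi_nonneg (div_nonneg (hf0 x hx) hw.le)
  · exact (measurable_Phi.comp (hf.div_const w)).aestronglyMeasurable
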